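/- For every sequence x = (x_k)_{k≥1} of points of the unit circle 𝕋 = ℝ/ℤ, the inequality d_n(x) ≤ φ_{n−1} holds for infinitely many integers n ≥ 2. -/

import Mathlib

/-- The minimal pairwise distance `d_n(x)` among the first `n` terms of a
sequence `x` in the unit circle `𝕋 = ℝ/ℤ`. -/
noncomputable def minSep (x : ℕ → AddCircle (1 : ℝ)) (n : ℕ) : ℝ :=
  sInf {d : ℝ | ∃ r s : ℕ, 1 ≤ r ∧ r < s ∧ s ≤ n ∧ d = dist (x r) (x s)}

/-- `φ_n = (ln(n+1) − ln n)/(2 ln 2)`. -/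
noncomputable def phi (n : ℕ) : ℝ :=
  (Real.log (n + 1) - Real.log n) / (2 * Real.log 2)

theorem gap_aux (δ : ℕ → ℝ) (hδ : Antitone δ) (y : ℕ → ℝ) :
    ∀ (k : ℕ) (S : Finset ℕ) (a b : ℝ) (m : ℕ), S.card = k → (∀ i ∈ S, m < i) →
      δ m ≤ b - a → (∀ i ∈ S, a + δ i ≤ y i ∧ y i ≤ b - δ i) →
      (∀ i ∈ S, ∀ j ∈ S, i < j → δ j ≤ |y i - y j|) →
      2 * ∑ i ∈ S, δ i ≤ b - a + ((S.card : ℝ) - 1) * δ m := by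
  intro k
  induction k using Nat.strong_induction_on with
  | _ k ih =>
    intro S a b m hk hm hab hy hd
    rcases S.eq_empty_or_nonempty with rfl | hne
    · simp; linarith
    · set j := S.min' hne with hj
      have hjS : j ∈ S := S.min'_mem hne
      have hlt : ∀ i ∈ S.erase j, j < i := fun i hi =>
        lt_of_le_of_ne (S.min'_le i (Finset.mem_of_mem_erase hi)) (Finset.ne_of_mem_erase hi).symm
      have hc : (S.erase j).card + 1 = S.card := Finset.card_erase_add_one hjS
      have hsum : ∑ i ∈ S.erase j, δ i + δ j = ∑ i ∈ S, δ i := Finset.sum_erase_add S δ hjS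
      set A := (S.erase j).filter (fun i => y i ≤ y j) with hA
      set B := (S.erase j).filter (fun i => ¬ y i ≤ y j) with hB
      have hcAB : A.card + B.card = (S.erase j).card :=
        Finset.card_filter_add_card_filter_not _
      have hsAB : ∑ i ∈ A, δ i + ∑ i ∈ B, δ i = ∑ i ∈ S.erase j, δ i :=
        Finset.sum_filter_add_sum_filter_not _ _ _
      have mA : ∀ i ∈ A, i ∈ S ∧ j < i ∧ y i ≤ y j := fun i hi => by
        have := Finset.mem_filter.1 hi
        exact ⟨Finset.mem_of_mem_erase this.1, hlt i this.1, this.2⟩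
      have mB : ∀ i ∈ B, i ∈ S ∧ j < i ∧ y j < y i := fun i hi => by
        have := Finset.mem_filter.1 hi
        exact ⟨Finset.mem_of_mem_erase this.1, hlt i this.1, not_le.1 this.2⟩
      have h1 := ih A.card (by omega) A a (y j) j rfl (fun i hi => (mA i hi).2.1)
        (by linarith [(hy j hjS).1])
        (fun i hi => by
          obtain ⟨h, h', h''⟩ := mA i hi
          have := hd j hjS i h h'
          rw [abs_of_nonneg (by linarith)] at this
          exact ⟨(hy i h).1, by linarith⟩)
        (fun i hi l hl => hd i (mA i hi).1 l (mA l hl).1)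
      have h2 := ih B.card (by omega) B (y j) b j rfl (fun i hi => (mB i hi).2.1)
        (by linarith [(hy j hjS).2])
        (fun i hi => by
          obtain ⟨h, h', h''⟩ := mB i hi
          have := hd j hjS i h h'
          rw [abs_of_nonpos (by linarith)] at this
          exact ⟨by linarith, (hy i h).2⟩)
        (fun i hi l hl => hd i (mB i hi).1 l (mB l hl).1)
      have hcR : (A.card : ℝ) + B.card + 1 = S.card := by
        rw [← hc, ← hcAB]; push_cast; ring
      have hmj : δ j ≤ δ m := hδ (hm j hjS).le
      have hpos : (0 : ℝ) ≤ (A.card : ℝ) + B.card := by positivity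
      have := mul_le_mul_of_nonneg_left hmj hpos
      rw [← hsum, ← hsAB, ← hcR]
      nlinarith

theorem minSep_le (x : ℕ → AddCircle (1 : ℝ)) {n r s : ℕ} (hr : 1 ≤ r) (hrs : r < s)
    (hs : s ≤ n) : minSep x n ≤ dist (x r) (x s) := by
  apply csInf_le
  · refine ⟨0, ?_⟩
    rintro d ⟨r, s, -, -, -, rfl⟩
    exact dist_nonneg
  · exact ⟨r, s, hr, hrs, hs, rfl⟩

theorem minSep_anti (x : ℕ → AddCircle (1 : ℝ)) {m n : ℕ} (hm : 2 ≤ m) (h : m ≤ n) :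
    minSep x n ≤ minSep x m := by
  apply csInf_le_csInf
  · refine ⟨0, ?_⟩
    rintro d ⟨r, s, -, -, -, rfl⟩
    exact dist_nonneg
  · exact ⟨_, 1, 2, le_rfl, by norm_num, hm, rfl⟩
  · rintro d ⟨r, s, h1, h2, h3, rfl⟩
    exact ⟨r, s, h1, h2, h3.trans h, rfl⟩

theorem norm_coe_le (z : ℝ) : ‖(z : AddCircle (1 : ℝ))‖ ≤ |z| := by
  have := QuotientAddGroup.norm_mk_le_norm (S := AddSubgroup.zmultiples (1:ℝ)) (m := z)
  exact this

theorem sum_minSep_le (x : ℕ → AddCircle (1 : ℝ)) (n : ℕ) (hn : 2 ≤ n) :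
    2 * ∑ i ∈ Finset.Ico n (2 * n), minSep x (i + 1) ≤ 1 := by
  have hex : ∀ j, ∃ z : ℝ, z ∈ Set.Ico (0 : ℝ) 1 ∧ (z : AddCircle (1 : ℝ)) = x j - x 1 := by
    intro j
    haveI : Fact ((0 : ℝ) < 1) := ⟨one_pos⟩
    refine ⟨(AddCircle.equivIco (1 : ℝ) 0 (x j - x 1)).1, ?_, ?_⟩
    · simpa using (AddCircle.equivIco (1 : ℝ) 0 (x j - x 1)).2
    · exact (AddCircle.equivIco (1 : ℝ) 0).symm_apply_apply (x j - x 1)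
  choose y hy hyx using hex
  have hdist : ∀ r s, dist (x r) (x s) ≤ |y r - y s| := by
    intro r s
    refine le_trans (le_of_eq ?_) (norm_coe_le _)
    rw [AddCircle.coe_sub, hyx, hyx, dist_eq_norm]; congr 1; abel
  have hd0 : ∀ s, dist (x 1) (x s) ≤ y s := by
    intro s
    refine le_trans (le_of_eq ?_) ((norm_coe_le (y s)).trans (abs_of_nonneg (hy s).1).le)
    rw [hyx, dist_comm, dist_eq_norm]
  have hd1 : ∀ s, dist (x 1) (x s) ≤ 1 - y s := by
    intro s
    refine le_trans (le_of_eq ?_)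
      ((norm_coe_le (1 - y s)).trans (abs_of_nonneg (by linarith [(hy s).2])).le)
    rw [AddCircle.coe_sub, hyx, AddCircle.coe_period, dist_eq_norm]; congr 1; abel
  have key := gap_aux (fun j => minSep x (max j n))
    (fun i j h => minSep_anti x (hn.trans (le_max_right _ _)) (max_le_max_right n h)) y _
    (Finset.Ico 2 (2 * n + 1)) 0 1 1 rfl (fun i hi => by have := Finset.mem_Ico.1 hi; omega)
    (by
      have h1 : minSep x (max 1 n) ≤ _ :=
        minSep_le x (r := 1) (s := 2) le_rfl (by norm_num) (by omega)
      have := hd0 2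
      have := (hy 2).2
      show minSep x (max 1 n) ≤ _
      linarith)
    (fun i hi => by
      have := Finset.mem_Ico.1 hi
      have h1 : minSep x (max i n) ≤ _ :=
        minSep_le x (r := 1) (s := i) le_rfl (by omega) (le_max_left _ _)
      have := hd0 i
      have := hd1 i
      exact ⟨by linarith, by linarith⟩)
    (fun i hi j hj hij => by
      have := Finset.mem_Ico.1 hi
      exact (minSep_le x (by omega) hij (le_max_left _ _)).trans (hdist i j))
  have hsplit : ∑ i ∈ Finset.Ico 2 (2 * n + 1), minSep x (max i n)
      = ((n : ℝ) - 1) * minSep x n + ∑ i ∈ Finset.Ico n (2 * n), minSep x (i + 1) := by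
    rw [← Finset.sum_Ico_consecutive _ (show 2 ≤ n + 1 by omega)
      (show n + 1 ≤ 2 * n + 1 by omega)]
    congr 1
    · rw [Finset.sum_congr rfl (g := fun _ => minSep x n)]
      · rw [Finset.sum_const, Nat.card_Ico, nsmul_eq_mul, Nat.cast_sub (by omega)]
        push_cast; ring
      · intro i hi
        have := Finset.mem_Ico.1 hi
        rw [max_eq_right (by omega)]
    · rw [← Finset.sum_Ico_add' (fun i => minSep x (max i n))]
      refine Finset.sum_congr rfl fun i hi => ?_
      have := Finset.mem_Ico.1 hi
      rw [max_eq_left (by omega)]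
  rw [hsplit, Nat.card_Ico, Nat.cast_sub (by omega), max_eq_right (show 1 ≤ n by omega)] at key
  push_cast at key
  nlinarith

theorem sum_phi (n : ℕ) (hn : 1 ≤ n) : 2 * ∑ i ∈ Finset.Ico n (2 * n), phi i = 1 := by
  have h := Finset.sum_Ico_sub (fun k : ℕ => Real.log k) (show n ≤ 2 * n by omega)
  have hn0 : (n : ℝ) ≠ 0 := by positivity
  have h2 : Real.log 2 ≠ 0 := (Real.log_pos (by norm_num)).ne'
  unfold phi
  rw [← Finset.sum_div]
  push_cast at h
  rw [h, Real.log_mul (by norm_num) hn0]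
  field_simp
  ring

/-- For any sequence `x` in the unit circle, the inequality `d_n(x) ≤ φ_{n−1}`
holds for infinitely many integers `n ≥ 2`. -/
theorem minSep_le_phi_frequently (x : ℕ → AddCircle (1 : ℝ)) :
    {n : ℕ | 2 ≤ n ∧ minSep x n ≤ phi (n - 1)}.Infinite := by
  intro hfin
  obtain ⟨N, hN⟩ := hfin.bddAbove
  have h1 := sum_minSep_le x (N + 2) (by omega)
  have h2 := sum_phi (N + 2) (by omega)
  have h3 : ∑ i ∈ Finset.Ico (N + 2) (2 * (N + 2)), phi i
      < ∑ i ∈ Finset.Ico (N + 2) (2 * (N + 2)), minSep x (i + 1) := by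
    apply Finset.sum_lt_sum_of_nonempty
    · exact Finset.nonempty_Ico.2 (by omega)
    · intro i hi
      have hi := Finset.mem_Ico.1 hi
      by_contra hcon
      have : i + 1 ≤ N := hN ⟨by omega, by simpa using hcon⟩
      omega
  linarith
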